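/- Let (g,h) be a split semisimple Lie algebra over a field of characteristic zero. Two finite-dimensional simple g-modules are isomorphic if and only if their highest weights (with respect to a fixed base of the root system) are equal. -/

import Mathlib

open LieModule

section HWAux

/-- Elements of `g` mapping `P` into `Q`. -/
def hwStab (k : Type*) [Field k] {g : Type*} [LieRing g] [LieAlgebra k g]
    {M : Type*} [AddCommGroup M] [Module k M] [LieRingModule g M] [LieModule k g M]
    (P Q : Submodule k M) : Submodule k g where
  carrier := {x | ∀ m ∈ P, ⁅x, m⁆ ∈ Q}
  add_mem' := by
    intro x y hx hy m hm
    rw [add_lie]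
    exact Q.add_mem (hx m hm) (hy m hm)
  zero_mem' := by
    intro m _
    simp
  smul_mem' := by
    intro a x hx m hm
    rw [smul_lie]
    exact Q.smul_mem a (hx m hm)

/-- A PBW-free version of `U(g) v = U(n⁻) v`. -/
theorem hw_lieSpan_le {k : Type*} [Field k] {g : Type*} [LieRing g] [LieAlgebra k g]
    {M : Type*} [AddCommGroup M] [Module k M] [LieRingModule g M] [LieModule k g M]
    (A B : Submodule k g) (hAB : A ⊔ B = ⊤) (v : M)
    (hB : ∀ x ∈ B, ⁅x, v⁆ ∈ Submodule.span k {v})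
    (P : Submodule k M) (hv : v ∈ P) (hA : ∀ x ∈ A, ∀ m ∈ P, ⁅x, m⁆ ∈ P) :
    ∀ m ∈ LieSubmodule.lieSpan k g ({v} : Set M), m ∈ P := by
  let F : Set (Submodule k M) := {Q | v ∈ Q ∧ ∀ x ∈ A, ∀ m ∈ Q, ⁅x, m⁆ ∈ Q}
  let N : Submodule k M := sInf F
  have hvN : v ∈ N := by
    rw [Submodule.mem_sInf]
    exact fun Q hQ => hQ.1
  have hAN : ∀ x ∈ A, ∀ m ∈ N, ⁅x, m⁆ ∈ N := by
    intro x hx m hm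
    rw [Submodule.mem_sInf] at hm ⊢
    exact fun Q hQ => hQ.2 x hx m (hm Q hQ)
  let N' : Submodule k M :=
    { carrier := {u | u ∈ N ∧ ∀ x ∈ B, ⁅x, u⁆ ∈ N}
      add_mem' := by
        rintro a b ⟨ha, ha'⟩ ⟨hb, hb'⟩
        refine ⟨N.add_mem ha hb, fun x hx => ?_⟩
        rw [lie_add]
        exact N.add_mem (ha' x hx) (hb' x hx)
      zero_mem' := ⟨N.zero_mem, fun x _ => by simp⟩
      smul_mem' := by
        rintro c a ⟨ha, ha'⟩
        refine ⟨N.smul_mem c ha, fun x hx => ?_⟩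
        rw [lie_smul]
        exact N.smul_mem c (ha' x hx) }
  have hN' : N' ∈ F := by
    refine ⟨⟨hvN, fun x hx => ?_⟩, ?_⟩
    · exact (Submodule.span_singleton_le_iff_mem v N).2 hvN (hB x hx)
    · rintro y hy u ⟨hu, hu'⟩
      refine ⟨hAN y hy u hu, fun x hx => ?_⟩
      rw [leibniz_lie]
      refine N.add_mem ?_ (hAN y hy _ (hu' x hx))
      have : ⁅x, y⁆ ∈ A ⊔ B := by rw [hAB]; trivial
      obtain ⟨a, ha, b, hb, hab⟩ := Submodule.mem_sup.1 this
      rw [← hab, add_lie]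
      exact N.add_mem (hAN a ha u hu) (hu' b hb)
  have hNN' : N ≤ N' := sInf_le hN'
  let L : LieSubmodule k g M :=
    { N with
      lie_mem := by
        intro x m hm
        have : x ∈ A ⊔ B := by rw [hAB]; trivial
        obtain ⟨a, ha, b, hb, hab⟩ := Submodule.mem_sup.1 this
        rw [← hab, add_lie]
        exact N.add_mem (hAN a ha m hm) ((hNN' hm).2 b hb) }
  have hL : LieSubmodule.lieSpan k g ({v} : Set M) ≤ L := by
    rw [LieSubmodule.lieSpan_le]
    rintro _ rfl
    exact hvN
  intro m hm
  have h1 : m ∈ N := hL hm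
  exact (sInf_le (show P ∈ F from ⟨hv, hA⟩) : N ≤ P) h1

variable {k : Type*} [Field k] [CharZero k]
    {g : Type*} [LieRing g] [LieAlgebra k g] [FiniteDimensional k g]
    {H : LieSubalgebra k g} [H.IsCartanSubalgebra] [IsTriangularizable k H g]
    {S : Finset (Weight k H g)}

/-- Natural number combinations of independent roots vanish only trivially. -/
theorem hw_coeff_zero {k : Type*} [Field k] [CharZero k]
    {g : Type*} [LieRing g] [LieAlgebra k g]
    {H : LieSubalgebra k g} [LieRing.IsNilpotent H]
    {S : Finset (Weight k H g)}
    (hSind : LinearIndependent k (fun α : S => ((α : Weight k H g) : H → k)))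
    (c : Weight k H g → ℕ) (hc : ∑ α ∈ S, (c α : k) • (α : H → k) = 0) :
    ∀ α ∈ S, c α = 0 := by
  intro α hα
  rw [← Finset.sum_coe_sort S (fun α => (c α : k) • (α : H → k))] at hc
  have := Fintype.linearIndependent_iff.1 hSind (fun α => (c α : k)) hc ⟨α, hα⟩
  exact_mod_cast this

/-- The generated submodule of a highest weight vector. -/
theorem hw_span
    (hSind : LinearIndependent k (fun α : S => ((α : Weight k H g) : H → k)))
    (hSbase : ∀ β : Weight k H g, β.IsNonZero →
      (∃ c : Weight k H g → ℕ, (β : H → k) = ∑ α ∈ S, (c α : k) • (α : H → k)) ∨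
      (∃ c : Weight k H g → ℕ, (β : H → k) = -∑ α ∈ S, (c α : k) • (α : H → k)))
    {M : Type*} [AddCommGroup M] [Module k M] [LieRingModule g M] [LieModule k g M]
    (v : M) (l : H → k) (hH : ∀ h : H, ⁅h, v⁆ = l h • v)
    (hpos : ∀ β : Weight k H g, β.IsNonZero →
      (∃ c : Weight k H g → ℕ, (β : H → k) = ∑ α ∈ S, (c α : k) • (α : H → k)) →
      ∀ x ∈ LieAlgebra.rootSpace H (β : H → k), ⁅x, v⁆ = 0) :
    ∀ m ∈ LieSubmodule.lieSpan k g ({v} : Set M),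
      m ∈ Submodule.span k {v} ⊔
        ⨆ χ ∈ {χ : H → k | χ ≠ l ∧ ∃ c : Weight k H g → ℕ,
          l = χ + ∑ α ∈ S, (c α : k) • (α : H → k)}, (genWeightSpace M χ).toSubmodule := by
  set T : Set (H → k) := {χ : H → k | χ ≠ l ∧ ∃ c : Weight k H g → ℕ,
          l = χ + ∑ α ∈ S, (c α : k) • (α : H → k)} with hT
  set Q : Submodule k M := ⨆ χ ∈ T, (genWeightSpace M χ).toSubmodule with hQ
  have hvl : v ∈ genWeightSpace M l := by
    rw [mem_genWeightSpace]
    intro x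
    refine ⟨1, ?_⟩
    simp [hH]
  let A : Submodule k g := ⨆ β ∈ {β : Weight k H g | β.IsNonZero ∧
    ∃ c : Weight k H g → ℕ, (β : H → k) = -∑ α ∈ S, (c α : k) • (α : H → k)},
      (LieAlgebra.rootSpace H (β : H → k)).toSubmodule
  let B : Submodule k g := hwStab k (Submodule.span k {v}) (Submodule.span k {v})
  have hA : A ≤ hwStab k (Submodule.span k {v} ⊔ Q) Q := by
    refine iSup₂_le ?_
    rintro β ⟨hβ0, c', hc'⟩ x hx m hm
    have key : ∀ (χ : H → k) (c : Weight k H g → ℕ),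
        l = χ + ∑ α ∈ S, (c α : k) • (α : H → k) → ((β : H → k) + χ) ∈ T := by
      intro χ c hc
      have hs : l = ((β : H → k) + χ) + ∑ α ∈ S, ((c + c') α : k) • (α : H → k) := by
        simp only [Pi.add_apply, add_smul, Nat.cast_add, Finset.sum_add_distrib]
        rw [hc, hc']
        abel
      refine ⟨fun h => hβ0 ?_, c + c', by simpa using hs⟩
      rw [h] at hs
      have h0 := hw_coeff_zero hSind (c + c') (by simpa using hs)
      change (β : H → k) = 0
      rw [hc', neg_eq_zero]
      refine Finset.sum_eq_zero fun α hα => ?_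
      have := h0 α hα
      have : c' α = 0 := by simp at this; exact this.2
      simp [this]
    have key2 : ∀ (χ : H → k) (c : Weight k H g → ℕ),
        l = χ + ∑ α ∈ S, (c α : k) • (α : H → k) → ∀ m ∈ genWeightSpace M χ, ⁅x, m⁆ ∈ Q := by
      intro χ c hc m hm
      have h1 := LieAlgebra.lie_mem_genWeightSpace_of_mem_genWeightSpace hx hm
      exact Submodule.mem_iSup_of_mem _ (Submodule.mem_iSup_of_mem (key χ c hc) h1)
    let R : Submodule k M := Q.comap (toEnd k g M x)
    have : Submodule.span k {v} ⊔ Q ≤ R := by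
      refine sup_le ?_ (iSup₂_le ?_)
      · rw [Submodule.span_singleton_le_iff_mem]
        exact key2 l 0 (by simp) v hvl
      · rintro χ ⟨_, c, hc⟩ m hm
        exact key2 χ c hc m hm
    exact this hm
  have hAB : A ⊔ B = ⊤ := by
    have h := iSup_genWeightSpace_eq_top' k H g
    rw [← LieSubmodule.toSubmodule_inj, LieSubmodule.iSup_toSubmodule,
      LieSubmodule.top_toSubmodule] at h
    rw [eq_top_iff, ← h]
    refine iSup_le fun β => ?_
    by_cases hβ : β.IsNonZero
    · rcases hSbase β hβ with hc | hc
      · refine le_sup_of_le_right ?_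
        intro x hx m hm
        obtain ⟨a, rfl⟩ := Submodule.mem_span_singleton.1 hm
        rw [lie_smul, hpos β hβ hc x hx]
        simp
      · exact le_sup_of_le_left (le_iSup₂_of_le β ⟨hβ, hc⟩ le_rfl)
    · refine le_sup_of_le_right ?_
      have h0 : (β : H → k) = 0 := by
        by_contra h'
        exact hβ h'
      rw [h0]
      intro x hx m hm
      have hx' : x ∈ H := by
        have : x ∈ LieAlgebra.rootSpace H (0 : H → k) := hx
        rw [LieAlgebra.rootSpace_zero_eq] at this
        simpa using this
      obtain ⟨a, rfl⟩ := Submodule.mem_span_singleton.1 hm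
      rw [lie_smul]
      have : ⁅x, v⁆ = l ⟨x, hx'⟩ • v := hH ⟨x, hx'⟩
      rw [this]
      exact Submodule.smul_mem _ _ (Submodule.smul_mem _ _ (Submodule.mem_span_singleton_self v))
  refine hw_lieSpan_le A B hAB v (fun x hx => hx v (Submodule.mem_span_singleton_self v)) _
    (Submodule.mem_sup_left (Submodule.mem_span_singleton_self v)) ?_
  intro x hx m hm
  exact Submodule.mem_sup_right (hA hx m hm)

theorem hw_indep (k : Type*) [Field k]
    {g : Type*} [LieRing g] [LieAlgebra k g]
    (H : LieSubalgebra k g) [LieRing.IsNilpotent H]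
    (M : Type*) [AddCommGroup M] [Module k M] [LieRingModule g M] [LieModule k g M] :
    iSupIndep fun χ : H → k ↦ (genWeightSpace M χ).toSubmodule := by
  rw [LieSubmodule.iSupIndep_toSubmodule]
  exact iSupIndep_genWeightSpace k H M

theorem hw_mem {k : Type*} [Field k]
    {g : Type*} [LieRing g] [LieAlgebra k g]
    {H : LieSubalgebra k g} [LieRing.IsNilpotent H]
    {M : Type*} [AddCommGroup M] [Module k M] [LieRingModule g M] [LieModule k g M]
    (v : M) (l : H → k) (hH : ∀ h : H, ⁅h, v⁆ = l h • v) : v ∈ genWeightSpace M l := by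
  rw [mem_genWeightSpace]
  intro x
  refine ⟨1, ?_⟩
  simp [hH]

/-- The highest weight space is one-dimensional. -/
theorem hw_onedim
    (hSind : LinearIndependent k (fun α : S => ((α : Weight k H g) : H → k)))
    (hSbase : ∀ β : Weight k H g, β.IsNonZero →
      (∃ c : Weight k H g → ℕ, (β : H → k) = ∑ α ∈ S, (c α : k) • (α : H → k)) ∨
      (∃ c : Weight k H g → ℕ, (β : H → k) = -∑ α ∈ S, (c α : k) • (α : H → k)))
    {M : Type*} [AddCommGroup M] [Module k M] [LieRingModule g M] [LieModule k g M]
    (v : M) (l : H → k) (hH : ∀ h : H, ⁅h, v⁆ = l h • v)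
    (hpos : ∀ β : Weight k H g, β.IsNonZero →
      (∃ c : Weight k H g → ℕ, (β : H → k) = ∑ α ∈ S, (c α : k) • (α : H → k)) →
      ∀ x ∈ LieAlgebra.rootSpace H (β : H → k), ⁅x, v⁆ = 0)
    (m : M) (hm : m ∈ LieSubmodule.lieSpan k g ({v} : Set M)) (hml : m ∈ genWeightSpace M l) :
    ∃ a : k, m = a • v := by
  obtain ⟨u, hu, q, hq, rfl⟩ := Submodule.mem_sup.1 (hw_span hSind hSbase v l hH hpos m hm)
  obtain ⟨a, rfl⟩ := Submodule.mem_span_singleton.1 hu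
  have hvl := hw_mem v l hH
  have hql : q ∈ (genWeightSpace M l).toSubmodule := by
    have := (genWeightSpace M l).toSubmodule.sub_mem hml
      ((genWeightSpace M l).toSubmodule.smul_mem a hvl)
    simpa using this
  have hd := (hw_indep k H M).disjoint_biSup (x := l)
    (y := {χ : H → k | χ ≠ l ∧ ∃ c : Weight k H g → ℕ,
          l = χ + ∑ α ∈ S, (c α : k) • (α : H → k)}) (fun h => h.1 rfl)
  have := Submodule.disjoint_def.1 hd q hql hq
  exact ⟨a, by simp [this]⟩

/-- All weights lie below the highest one. -/
theorem hw_below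
    (hSind : LinearIndependent k (fun α : S => ((α : Weight k H g) : H → k)))
    (hSbase : ∀ β : Weight k H g, β.IsNonZero →
      (∃ c : Weight k H g → ℕ, (β : H → k) = ∑ α ∈ S, (c α : k) • (α : H → k)) ∨
      (∃ c : Weight k H g → ℕ, (β : H → k) = -∑ α ∈ S, (c α : k) • (α : H → k)))
    {M : Type*} [AddCommGroup M] [Module k M] [LieRingModule g M] [LieModule k g M]
    (v : M) (l : H → k) (hH : ∀ h : H, ⁅h, v⁆ = l h • v)
    (hpos : ∀ β : Weight k H g, β.IsNonZero →
      (∃ c : Weight k H g → ℕ, (β : H → k) = ∑ α ∈ S, (c α : k) • (α : H → k)) →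
      ∀ x ∈ LieAlgebra.rootSpace H (β : H → k), ⁅x, v⁆ = 0)
    (htop : LieSubmodule.lieSpan k g ({v} : Set M) = ⊤) (χ : Weight k H M) :
    ∃ c : Weight k H g → ℕ, l = (χ : H → k) + ∑ α ∈ S, (c α : k) • (α : H → k) := by
  by_contra hχ
  apply χ.genWeightSpace_ne_bot
  have hd := (hw_indep k H M).disjoint_biSup (x := (χ : H → k))
    (y := {χ : H → k | ∃ c : Weight k H g → ℕ,
          l = χ + ∑ α ∈ S, (c α : k) • (α : H → k)}) (fun h => hχ h)
  rw [LieSubmodule.eq_bot_iff]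
  intro m hm
  refine Submodule.disjoint_def.1 hd m hm ?_
  have hm' := hw_span hSind hSbase v l hH hpos m (by rw [htop]; trivial)
  refine (sup_le ?_ ?_ : _ ≤ (_ : Submodule k M)) hm'
  · rw [Submodule.span_singleton_le_iff_mem]
    exact Submodule.mem_iSup_of_mem l (Submodule.mem_iSup_of_mem
      ⟨0, by simp⟩ (hw_mem v l hH))
  · exact biSup_mono fun χ h => h.2

/-- Existence of a highest weight vector. -/
theorem hw_exists
    {V : Type*} [AddCommGroup V] [Module k V] [LieRingModule g V] [LieModule k g V]
    [FiniteDimensional k V]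
    (ϖV : Weight k H V)
    (hmaxV : ∀ χ : Weight k H V,
      (∃ c : Weight k H g → ℕ,
        (χ : H → k) = (ϖV : H → k) + ∑ α ∈ S, (c α : k) • (α : H → k)) →
      (χ : H → k) = (ϖV : H → k)) :
    ∃ v : V, v ≠ 0 ∧ (∀ h : H, ⁅h, v⁆ = ϖV h • v) ∧
      (∀ β : Weight k H g, β.IsNonZero →
      (∃ c : Weight k H g → ℕ, (β : H → k) = ∑ α ∈ S, (c α : k) • (α : H → k)) →
      ∀ x ∈ LieAlgebra.rootSpace H (β : H → k), ⁅x, v⁆ = 0) := by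
  obtain ⟨v, hv0, hv⟩ := exists_forall_lie_eq_smul k H V ϖV
  refine ⟨v, hv0, hv, ?_⟩
  rintro β hβ ⟨c, hc⟩ x hx
  have h1 := LieAlgebra.lie_mem_genWeightSpace_of_mem_genWeightSpace hx
    (hw_mem v (ϖV : H → k) hv)
  by_contra hne
  have hbot : genWeightSpace V ((β : H → k) + (ϖV : H → k)) ≠ ⊥ := by
    intro hb
    rw [hb] at h1
    exact hne (by simpa using h1)
  have h2 : (β : H → k) + (ϖV : H → k) = ϖV :=
    hmaxV ⟨_, hbot⟩ ⟨c, by rw [← hc]; exact add_comm _ _⟩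
  exact hβ (by simpa using h2)

theorem hw_lieSpan_top
    {k : Type*} [Field k] {g : Type*} [LieRing g] [LieAlgebra k g]
    {V : Type*} [AddCommGroup V] [Module k V] [LieRingModule g V] [LieModule k g V]
    [IsIrreducible k g V] (v : V) (hv : v ≠ 0) :
    LieSubmodule.lieSpan k g ({v} : Set V) = ⊤ := by
  refine (eq_bot_or_eq_top _).resolve_left ?_
  intro h
  have : v ∈ LieSubmodule.lieSpan k g ({v} : Set V) := LieSubmodule.subset_lieSpan rfl
  rw [h] at this
  exact hv (by simpa using this)

instance hwProdRing {g : Type*} [LieRing g] {V W : Type*} [AddCommGroup V] [AddCommGroup W]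
    [LieRingModule g V] [LieRingModule g W] : LieRingModule g (V × W) where
  bracket x m := (⁅x, m.1⁆, ⁅x, m.2⁆)
  add_lie x y m := by ext <;> exact add_lie _ _ _
  lie_add x m n := by ext <;> exact lie_add _ _ _
  leibniz_lie x y m := by ext <;> exact leibniz_lie _ _ _

theorem hw_prod_lie {g : Type*} [LieRing g] {V W : Type*} [AddCommGroup V] [AddCommGroup W]
    [LieRingModule g V] [LieRingModule g W] (x : g) (m : V × W) :
    ⁅x, m⁆ = (⁅x, m.1⁆, ⁅x, m.2⁆) := rfl

instance hwProdMod {k : Type*} [Field k] {g : Type*} [LieRing g] [LieAlgebra k g]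
    {V W : Type*} [AddCommGroup V] [AddCommGroup W]
    [LieRingModule g V] [LieRingModule g W] [Module k V] [Module k W]
    [LieModule k g V] [LieModule k g W] : LieModule k g (V × W) where
  smul_lie t x m := by ext <;> exact smul_lie _ _ _
  lie_smul t x m := by ext <;> exact lie_smul _ _ _

/-- A nonzero injective map to an irreducible module is an isomorphism. -/
theorem hw_equiv {k : Type*} [Field k] {g : Type*} [LieRing g] [LieAlgebra k g]
    {N V : Type*} [AddCommGroup N] [AddCommGroup V]
    [LieRingModule g N] [LieRingModule g V] [Module k N] [Module k V]
    [LieModule k g N] [LieModule k g V] [IsIrreducible k g V]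
    (f : N →ₗ⁅k,g⁆ V) (hf : ∀ n, f n = 0 → n = 0) (n : N) (hn : f n ≠ 0) :
    Nonempty (N ≃ₗ⁅k,g⁆ V) := by
  have hinj : Function.Injective f := (injective_iff_map_eq_zero f).2 hf
  have htop : f.range = ⊤ := by
    refine (eq_bot_or_eq_top _).resolve_left ?_
    intro h
    have : f n ∈ f.range := (LieModuleHom.mem_range f _).2 ⟨n, rfl⟩
    rw [h] at this
    exact hn (by simpa using this)
  have hsurj : Function.Surjective f := by
    intro y
    have : y ∈ f.range := by rw [htop]; trivial
    exact (LieModuleHom.mem_range f _).1 this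
  exact ⟨{ f with
    invFun := (LinearEquiv.ofBijective (f : N →ₗ[k] V) ⟨hinj, hsurj⟩).symm
    left_inv := (LinearEquiv.ofBijective (f : N →ₗ[k] V) ⟨hinj, hsurj⟩).left_inv
    right_inv := (LinearEquiv.ofBijective (f : N →ₗ[k] V) ⟨hinj, hsurj⟩).right_inv }⟩

/-- A submodule of `M` pulled back to an irreducible module, missing a vector, is trivial. -/
theorem hw_comap {k : Type*} [Field k] {g : Type*} [LieRing g] [LieAlgebra k g]
    {M V : Type*} [AddCommGroup M] [AddCommGroup V]
    [LieRingModule g M] [LieRingModule g V] [Module k M] [Module k V]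
    [LieModule k g M] [LieModule k g V] [IsIrreducible k g V]
    (N : LieSubmodule k g M) (f : V →ₗ⁅k,g⁆ M) (v : V) (hv : f v ∉ N) (x : V) (hx : f x ∈ N) :
    x = 0 := by
  by_contra hne
  have : N.comap f = ⊤ := by
    refine (eq_bot_or_eq_top _).resolve_left ?_
    intro h
    have h' : x ∈ N.comap f := hx
    rw [h] at h'
    exact hne (by simpa using h')
  have h2 : v ∈ N.comap f := by rw [this]; trivial
  exact hv h2

end HWAux



/-- Let `(g, H)` be a split semisimple Lie algebra over a field of characteristic zero with a
fixed base `S` of its root system.  Two finite-dimensional simple `g`-modules are isomorphic if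
and only if their highest weights (the weights maximal with respect to `S`) are equal. -/
theorem simple_modules_iso_iff_highest_weights_eq
    (k : Type*) [Field k] [CharZero k]
    (g : Type*) [LieRing g] [LieAlgebra k g] [FiniteDimensional k g]
    [LieAlgebra.HasTrivialRadical k g]
    (H : LieSubalgebra k g) [H.IsCartanSubalgebra] [IsTriangularizable k H g]
    (S : Finset (Weight k H g))
    (hS0 : ∀ α ∈ S, (α : Weight k H g).IsNonZero)
    (hSind : LinearIndependent k (fun α : S => ((α : Weight k H g) : H → k)))
    (hSbase : ∀ β : Weight k H g, β.IsNonZero →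
      (∃ c : Weight k H g → ℕ, (β : H → k) = ∑ α ∈ S, (c α : k) • (α : H → k)) ∨
      (∃ c : Weight k H g → ℕ, (β : H → k) = -∑ α ∈ S, (c α : k) • (α : H → k)))
    (V : Type*) [AddCommGroup V] [Module k V] [LieRingModule g V] [LieModule k g V]
    [FiniteDimensional k V] [IsIrreducible k g V]
    (W : Type*) [AddCommGroup W] [Module k W] [LieRingModule g W] [LieModule k g W]
    [FiniteDimensional k W] [IsIrreducible k g W]
    (ϖV : Weight k H V)
    (hmaxV : ∀ χ : Weight k H V,
      (∃ c : Weight k H g → ℕ,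
        (χ : H → k) = (ϖV : H → k) + ∑ α ∈ S, (c α : k) • (α : H → k)) →
      (χ : H → k) = (ϖV : H → k))
    (ϖW : Weight k H W)
    (hmaxW : ∀ χ : Weight k H W,
      (∃ c : Weight k H g → ℕ,
        (χ : H → k) = (ϖW : H → k) + ∑ α ∈ S, (c α : k) • (α : H → k)) →
      (χ : H → k) = (ϖW : H → k)) :
    Nonempty (V ≃ₗ⁅k,g⁆ W) ↔ (ϖV : H → k) = (ϖW : H → k) := by
  obtain ⟨v, hv0, hvH, hvp⟩ := hw_exists ϖV hmaxV
  obtain ⟨w, hw0, hwH, hwp⟩ := hw_exists ϖW hmaxW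
  constructor
  · rintro ⟨e⟩
    apply hmaxW ⟨(ϖV : H → k), ?_⟩
    · have hne : genWeightSpace V (ϖW : H → k) ≠ ⊥ := by
        intro hb
        have hmem : e.symm w ∈ genWeightSpace V (ϖW : H → k) := by
          apply hw_mem
          intro h
          have : ⁅(h : g), e.symm w⁆ = e.symm ⁅(h : g), w⁆ := (LieModuleHom.map_lie e.symm.toLieModuleHom _ _).symm
          have h3 : ⁅(h : g), w⁆ = ϖW h • w := hwH h
          rw [h3] at this
          exact this.trans (map_smul e.symm.toLieModuleHom _ _)
        rw [hb, LieSubmodule.mem_bot] at hmem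
        apply hw0
        have := congrArg e hmem
        simpa using this
      exact hw_below hSind hSbase v _ hvH hvp (hw_lieSpan_top v hv0) ⟨_, hne⟩
    · intro hb
      have hmem : e v ∈ genWeightSpace W (ϖV : H → k) := by
        apply hw_mem
        intro h
        have : ⁅(h : g), e v⁆ = e ⁅(h : g), v⁆ := (LieModuleHom.map_lie e.toLieModuleHom _ _).symm
        have h3 : ⁅(h : g), v⁆ = ϖV h • v := hvH h
        rw [h3] at this
        exact this.trans (map_smul e.toLieModuleHom _ _)
      rw [hb, LieSubmodule.mem_bot] at hmem
      apply hv0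
      have := congrArg e.symm hmem
      simpa using this
  · intro heq
    have hwH' : ∀ h : H, ⁅h, w⁆ = ϖV h • w := by
      intro h
      rw [hwH h, congrFun heq h]
    let N := LieSubmodule.lieSpan k g ({(v, w)} : Set (V × W))
    have hvwN : (v, w) ∈ N := LieSubmodule.subset_lieSpan rfl
    have hgen : ∀ p : V × W, p ∈ N → (∀ h : H, ⁅h, p⁆ = ϖV h • p) → ∃ a : k, p = a • (v, w) := by
      intro p hp hpH
      refine hw_onedim hSind hSbase (v, w) (ϖV : H → k) ?_ ?_ p hp (hw_mem p _ hpH)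
      · intro h
        exact Prod.ext (hvH h) (hwH' h)
      · intro β hβ hc x hx
        exact Prod.ext (hvp β hβ hc x hx) (hwp β hβ hc x hx)
    let inl : V →ₗ⁅k,g⁆ V × W :=
      { LinearMap.inl k V W with
        map_lie' := by
          intro x m
          exact Prod.ext rfl (lie_zero x).symm }
    let inr : W →ₗ⁅k,g⁆ V × W :=
      { LinearMap.inr k V W with
        map_lie' := by
          intro x m
          exact Prod.ext (lie_zero x).symm rfl }
    let fst : N →ₗ⁅k,g⁆ V :=
      { (LinearMap.fst k V W).comp N.toSubmodule.subtype with
        map_lie' := by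
          intro x m
          rfl }
    let snd : N →ₗ⁅k,g⁆ W :=
      { (LinearMap.snd k V W).comp N.toSubmodule.subtype with
        map_lie' := by
          intro x m
          rfl }
    have hl : inl v ∉ N := by
      intro h
      obtain ⟨a, ha⟩ := hgen _ h (fun h => Prod.ext (hvH h) (by
        change ⁅(h : g), (0 : W)⁆ = ϖV h • (0 : W)
        simp))
      have h1 : v = a • v := congrArg Prod.fst ha
      have h2 : (0 : W) = a • w := congrArg Prod.snd ha
      rcases smul_eq_zero.1 h2.symm with h3 | h3
      · rw [h3, zero_smul] at h1
        exact hv0 h1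
      · exact hw0 h3
    have hr : inr w ∉ N := by
      intro h
      obtain ⟨a, ha⟩ := hgen _ h (fun h => Prod.ext (by
        change ⁅(h : g), (0 : V)⁆ = ϖV h • (0 : V)
        simp) (hwH' h))
      have h1 : (0 : V) = a • v := congrArg Prod.fst ha
      have h2 : w = a • w := congrArg Prod.snd ha
      rcases smul_eq_zero.1 h1.symm with h3 | h3
      · rw [h3, zero_smul] at h2
        exact hw0 h2
      · exact hv0 h3
    obtain ⟨e1⟩ := hw_equiv fst (by
      rintro ⟨⟨a, b⟩, hab⟩ h
      have ha : a = 0 := h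
      subst ha
      have hb : b = 0 := hw_comap N inr w hr b hab
      subst hb
      rfl) ⟨(v, w), hvwN⟩ hv0
    obtain ⟨e2⟩ := hw_equiv snd (by
      rintro ⟨⟨a, b⟩, hab⟩ h
      have hb : b = 0 := h
      subst hb
      have ha : a = 0 := hw_comap N inl v hl a hab
      subst ha
      rfl) ⟨(v, w), hvwN⟩ hw0
    exact ⟨e1.symm.trans e2⟩
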